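/- arXiv:2106.10322 — 6 statements merged into one kernel-verified Lean document; each statement's English description precedes it below -/
import Mathlib

section
/- There exists a constant C > 0 such that for every t > 0 and every λ ≥ 0 one has |𝒟(t,λ)| ≤ C and |∂ₜ𝒟(t,λ)| ≤ C. (Uniform boundedness of the damped-wave symbol and its time derivative; Lemma 4.1 of the paper.) -/
/-- The damped wave symbol `𝒟(t,λ)`. -/
noncomputable def dwSymbol (t lam : ℝ) : ℝ :=
  if lam < 1/4 then
    Real.exp (-t/2) * Real.sinh (t * Real.sqrt (1/4 - lam)) / Real.sqrt (1/4 - lam)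
  else if lam = 1/4 then t * Real.exp (-t/2)
  else Real.exp (-t/2) * Real.sin (t * Real.sqrt (lam - 1/4)) / Real.sqrt (lam - 1/4)

/-- The time derivative `∂ₜ𝒟(t,λ)`. -/
noncomputable def dwSymbolDt (t lam : ℝ) : ℝ :=
  if lam ≤ 1/4 then
    -(dwSymbol t lam) / 2 + Real.exp (-t/2) * Real.cosh (t * Real.sqrt (1/4 - lam))
  else
    -(dwSymbol t lam) / 2 + Real.exp (-t/2) * Real.cos (t * Real.sqrt (lam - 1/4))

theorem mul_exp_neg_le_inv {a : ℝ} (ha : 0 < a) (t : ℝ) : t * Real.exp (-(a * t)) ≤ 1 / a := by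
  have h : a * t ≤ Real.exp (a * t) := by linarith [Real.add_one_le_exp (a * t)]
  rw [Real.exp_neg, ← div_eq_mul_inv, div_le_div_iff₀ (Real.exp_pos _) ha]
  linarith

theorem sinh_le_mul_exp (x : ℝ) : Real.sinh x ≤ x * Real.exp x := by
  have h : Real.exp (-x) = Real.exp x * Real.exp (-2 * x) := by
    rw [← Real.exp_add]
    ring_nf
  rw [Real.sinh_eq, h]
  nlinarith [mul_le_mul_of_nonneg_left (Real.add_one_le_exp (-2 * x)) (Real.exp_pos x).le]

theorem exp_mul_sinh_div_le_four {t s : ℝ} (ht : 0 < t) (hs : 0 < s) (hs' : s ≤ 1 / 2) :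
    Real.exp (-t / 2) * Real.sinh (t * s) / s ≤ 4 := by
  rw [div_le_iff₀ hs]
  have he := Real.exp_pos (-t / 2)
  rcases le_or_gt (1 / 4) s with h | h
  · have h1 : Real.sinh (t * s) ≤ Real.exp (t * s) := by
      rw [Real.sinh_eq]
      linarith [Real.exp_pos (t * s), Real.exp_pos (-(t * s))]
    have h2 : Real.exp (-t / 2) * Real.exp (t * s) ≤ 1 := by
      rw [← Real.exp_add, Real.exp_le_one_iff]
      nlinarith
    linarith [mul_le_mul_of_nonneg_left h1 he.le]
  · have h1 : Real.exp (-t / 2) * Real.exp (t * s) ≤ Real.exp (-(1 / 4 * t)) := by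
      rw [← Real.exp_add, Real.exp_le_exp]
      nlinarith
    have h2 := mul_exp_neg_le_inv (a := 1 / 4) (by norm_num) t
    calc Real.exp (-t / 2) * Real.sinh (t * s)
        ≤ Real.exp (-t / 2) * (t * s * Real.exp (t * s)) :=
          mul_le_mul_of_nonneg_left (sinh_le_mul_exp _) he.le
      _ = t * s * (Real.exp (-t / 2) * Real.exp (t * s)) := by ring
      _ ≤ t * s * Real.exp (-(1 / 4 * t)) := mul_le_mul_of_nonneg_left h1 (by positivity)
      _ = t * Real.exp (-(1 / 4 * t)) * s := by ring
      _ ≤ 4 * s := mul_le_mul_of_nonneg_right (by linarith) hs.le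

theorem mul_exp_neg_half_le_two (t : ℝ) : t * Real.exp (-t / 2) ≤ 2 := by
  have h := mul_exp_neg_le_inv (a := 1 / 2) (by norm_num) t
  rw [show -(1 / 2 * t) = -t / 2 by ring] at h
  linarith

theorem sqrt_quarter_sub_le_half {lam : ℝ} (hl : 0 ≤ lam) : √(1 / 4 - lam) ≤ 1 / 2 :=
  Real.sqrt_le_iff.mpr ⟨by norm_num, by linarith⟩

theorem abs_dwSymbol_le_four {t lam : ℝ} (ht : 0 < t) (hl : 0 ≤ lam) : |dwSymbol t lam| ≤ 4 := by
  unfold dwSymbol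
  split_ifs with h1 h2
  · have hs : 0 < √(1 / 4 - lam) := Real.sqrt_pos.mpr (by linarith)
    have hsinh : 0 ≤ Real.sinh (t * √(1 / 4 - lam)) := Real.sinh_nonneg_iff.mpr (by positivity)
    rw [abs_of_nonneg (by positivity)]
    exact exp_mul_sinh_div_le_four ht hs (sqrt_quarter_sub_le_half hl)
  · rw [abs_of_nonneg (by positivity)]
    linarith [mul_exp_neg_half_le_two t]
  · have hs : 0 < √(lam - 1 / 4) :=
      Real.sqrt_pos.mpr (sub_pos.mpr (lt_of_le_of_ne (not_lt.mp h1) (Ne.symm h2)))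
    have hsin : |Real.sin (t * √(lam - 1 / 4))| ≤ t * √(lam - 1 / 4) :=
      Real.abs_sin_le_abs.trans_eq (abs_of_pos (by positivity))
    rw [abs_div, abs_mul, Real.abs_exp, abs_of_pos hs, div_le_iff₀ hs]
    nlinarith [mul_le_mul_of_nonneg_left hsin (Real.exp_pos (-t / 2)).le,
      mul_le_mul_of_nonneg_right (mul_exp_neg_half_le_two t) hs.le]

theorem abs_exp_mul_cosh_le_one {t s : ℝ} (ht : 0 ≤ t) (hs : 0 ≤ s) (hs' : s ≤ 1 / 2) :
    |Real.exp (-t / 2) * Real.cosh (t * s)| ≤ 1 := by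
  have h : Real.cosh (t * s) ≤ Real.exp (t * s) := by
    rw [Real.cosh_eq]
    have : Real.exp (-(t * s)) ≤ Real.exp (t * s) := Real.exp_le_exp.mpr (by nlinarith)
    linarith
  rw [abs_of_pos (mul_pos (Real.exp_pos _) (Real.cosh_pos _))]
  refine (mul_le_mul_of_nonneg_left h (Real.exp_pos _).le).trans ?_
  rw [← Real.exp_add, Real.exp_le_one_iff]
  nlinarith

theorem abs_exp_mul_cos_le_one {t : ℝ} (ht : 0 ≤ t) (x : ℝ) :
    |Real.exp (-t / 2) * Real.cos x| ≤ 1 := by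
  rw [abs_mul, Real.abs_exp]
  exact mul_le_one₀ (Real.exp_le_one_iff.mpr (by linarith)) (abs_nonneg _) (Real.abs_cos_le_one x)

theorem abs_dwSymbolDt_le_four {t lam : ℝ} (ht : 0 < t) (hl : 0 ≤ lam) :
    |dwSymbolDt t lam| ≤ 4 := by
  have hD := abs_le.mp (abs_dwSymbol_le_four ht hl)
  unfold dwSymbolDt
  split_ifs with h
  · have h1 := abs_le.mp
      (abs_exp_mul_cosh_le_one ht.le (Real.sqrt_nonneg _) (sqrt_quarter_sub_le_half hl))
    exact abs_le.mpr ⟨by linarith, by linarith⟩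
  · have h1 := abs_le.mp (abs_exp_mul_cos_le_one ht.le (t * √(lam - 1 / 4)))
    exact abs_le.mpr ⟨by linarith, by linarith⟩

theorem uniform_bound_dwSymbol :
    ∃ C > (0:ℝ), ∀ t > (0:ℝ), ∀ lam ≥ (0:ℝ),
      |dwSymbol t lam| ≤ C ∧ |dwSymbolDt t lam| ≤ C :=
  ⟨4, by norm_num, fun _ ht _ hl => ⟨abs_dwSymbol_le_four ht hl, abs_dwSymbolDt_le_four ht hl⟩⟩
end

section
/- For every t > 0 and every λ with 0 ≤ λ ≤ 1/8 one has 0 ≤ 𝒟(t,λ) ≤ √2. -/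
theorem dwSymbol_low_freq_bound :
    ∀ t > (0:ℝ), ∀ lam : ℝ, 0 ≤ lam → lam ≤ 1/8 →
      0 ≤ dwSymbol t lam ∧ dwSymbol t lam ≤ Real.sqrt 2 := by
  intro t ht lam h0 h1
  have hlt : lam < 1/4 := by linarith
  rw [dwSymbol, if_pos hlt]
  have hs : 0 < Real.sqrt (1/4 - lam) := Real.sqrt_pos.mpr (by linarith)
  have hs_le : Real.sqrt (1/4 - lam) ≤ 1/2 :=
    Real.sqrt_le_iff.mpr ⟨by norm_num, by linarith⟩
  have hs_ge : 1/2 ≤ Real.sqrt 2 * Real.sqrt (1/4 - lam) := by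
    rw [← Real.sqrt_mul (by norm_num)]
    exact Real.le_sqrt_of_sq_le (by linarith)
  generalize Real.sqrt (1/4 - lam) = s at hs hs_le hs_ge ⊢
  refine ⟨div_nonneg (mul_nonneg (Real.exp_pos _).le
    (Real.sinh_nonneg_iff.mpr (by positivity))) hs.le, ?_⟩
  rw [div_le_iff₀ hs]
  refine le_trans ?_ hs_ge
  rw [Real.sinh_eq, mul_div_assoc', mul_sub, ← Real.exp_add]
  have hexp : Real.exp (-t/2 + t * s) ≤ 1 := Real.exp_le_one_iff.mpr (by nlinarith)
  have hpos : 0 < Real.exp (-t/2) * Real.exp (-(t * s)) := by positivity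
  linarith
end

section
/- There exists a constant C > 0 such that for every t ≥ 1 and every λ with 0 ≤ λ < 1/8 one has |e^{tλ/2}·(𝒟(t,λ) − e^{−tλ})| ≤ C·⟨t⟩^{−1}. (Scalar form of the low-frequency diffusion comparison, Lemma 4.2 of the paper.) -/
/-- Factorisation of the weighted difference in terms of `a = 1/2 - √(1/4 - λ)`,
for which `λ = a * (1 - a)`. -/
theorem exp_mul_dwSymbol_sub_exp {t a : ℝ} (ha : a < 1/2) :
    Real.exp (t * (a * (1 - a)) / 2)
        * (dwSymbol t (a * (1 - a)) - Real.exp (-t * (a * (1 - a)))) * (1 - 2 * a)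
      = Real.exp (-(t * (a * (1 - a)) / 2)) * (Real.exp (-(t * a ^ 2)) - 1 + 2 * a)
        - Real.exp (t * (a * (1 - a)) / 2 - t * (1 - a)) := by
  have hsqrt : Real.sqrt (1/4 - a * (1 - a)) = 1/2 - a := by
    rw [show 1/4 - a * (1 - a) = (1/2 - a) ^ 2 by ring]
    exact Real.sqrt_sq (by linarith)
  have hlt : a * (1 - a) < 1/4 := by nlinarith [mul_pos (sub_pos.2 ha) (sub_pos.2 ha)]
  have hne : 1/2 - a ≠ 0 := by linarith
  have h₁ : Real.exp (t * (a * (1 - a)) / 2) * Real.exp (-t/2) * Real.exp (t * (1/2 - a))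
      = Real.exp (-(t * (a * (1 - a)) / 2)) * Real.exp (-(t * a ^ 2)) := by
    simp only [← Real.exp_add]; congr 1; ring
  have h₂ : Real.exp (t * (a * (1 - a)) / 2) * Real.exp (-t/2) * Real.exp (-(t * (1/2 - a)))
      = Real.exp (t * (a * (1 - a)) / 2 - t * (1 - a)) := by
    simp only [← Real.exp_add]; congr 1; ring
  have h₃ : Real.exp (t * (a * (1 - a)) / 2) * Real.exp (-t * (a * (1 - a)))
      = Real.exp (-(t * (a * (1 - a)) / 2)) := by
    rw [← Real.exp_add]; congr 1; ring
  have hD : dwSymbol t (a * (1 - a)) * (1 - 2 * a)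
      = Real.exp (-t/2) * (Real.exp (t * (1/2 - a)) - Real.exp (-(t * (1/2 - a)))) := by
    rw [dwSymbol, if_pos hlt, hsqrt, Real.sinh_eq, show 1 - 2 * a = 2 * (1/2 - a) by ring,
      div_mul_eq_mul_div, div_eq_iff hne]
    ring
  linear_combination Real.exp (t * (a * (1 - a)) / 2) * hD + h₁ - h₂ - (1 - 2 * a) * h₃

theorem dwSymbol_diffusion_comparison :
    ∃ C > (0:ℝ), ∀ t ≥ (1:ℝ), ∀ lam : ℝ, 0 ≤ lam → lam < 1/8 →
      |Real.exp (t * lam / 2) * (dwSymbol t lam - Real.exp (-t * lam))|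
        ≤ C * (Real.sqrt (1 + t^2))⁻¹ := by
  refine ⟨60, by norm_num, fun t ht lam h0 h8 => ?_⟩
  obtain ⟨a, ha0, ha6, rfl⟩ : ∃ a : ℝ, 0 ≤ a ∧ a ≤ 1/6 ∧ lam = a * (1 - a) := by
    have hsq := Real.sq_sqrt (show 0 ≤ 1/4 - lam by linarith)
    refine ⟨1/2 - Real.sqrt (1/4 - lam), ?_, ?_, by linarith⟩
    · have : Real.sqrt (1/4 - lam) ≤ 1/2 := Real.sqrt_le_iff.2 ⟨by norm_num, by linarith⟩
      linarith
    · have : 1/3 ≤ Real.sqrt (1/4 - lam) := Real.le_sqrt_of_sq_le (by linarith)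
      linarith
  have ht0 : 0 < t := by linarith
  have hfac := exp_mul_dwSymbol_sub_exp (t := t) (a := a) (by linarith)
  set P := Real.exp (t * (a * (1 - a)) / 2)
    * (dwSymbol t (a * (1 - a)) - Real.exp (-t * (a * (1 - a))))
  set x := t * (a * (1 - a)) / 2 with hx
  have hx0 : 0 ≤ x := by positivity
  have hxa : 5/12 * (t * a) ≤ x := by
    have : 0 ≤ t * a * (1/6 - a) := mul_nonneg (by positivity) (by linarith)
    rw [hx]; linarith
  have hE0 := Real.exp_pos (-x)
  have hmul : Real.exp (-x) * Real.exp x = 1 := by rw [← Real.exp_add]; simp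
  have hE1 : Real.exp (-x) * x ≤ 1 := by
    nlinarith [Real.add_one_le_exp x]
  have hE2 : Real.exp (-x) * x ^ 2 ≤ 2 := by
    nlinarith [Real.quadratic_le_exp_of_nonneg hx0, mul_nonneg hE0.le hx0]
  have hta1 : Real.exp (-x) * (t * a) ≤ 12/5 := by
    nlinarith [mul_le_mul_of_nonneg_left hxa hE0.le]
  have hta2 : Real.exp (-x) * (t * a) ^ 2 ≤ 12 := by
    have : (5/12 * (t * a)) ^ 2 ≤ x ^ 2 := by gcongr
    nlinarith [mul_le_mul_of_nonneg_left this hE0.le]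
  have hF : t * Real.exp (x - t * (1 - a)) ≤ 2 := by
    have hle : Real.exp (x - t * (1 - a)) ≤ Real.exp (-(t/2)) := by
      apply Real.exp_le_exp.2
      rw [hx]
      nlinarith
    have hm : Real.exp (-(t/2)) * Real.exp (t/2) = 1 := by rw [← Real.exp_add]; simp
    have h2 : Real.exp (-(t/2)) * (t/2) ≤ 1 := by
      nlinarith [Real.add_one_le_exp (t/2), Real.exp_pos (-(t/2))]
    nlinarith
  have hu : 1 - t * a ^ 2 ≤ Real.exp (-(t * a ^ 2)) := by
    linarith [Real.add_one_le_exp (-(t * a ^ 2))]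
  have hu1 : Real.exp (-(t * a ^ 2)) ≤ 1 := Real.exp_le_one_iff.2 (by simp; positivity)
  have hF0 := Real.exp_pos (x - t * (1 - a))
  have hlower : -(14/t) ≤ P * (1 - 2 * a) := by
    rw [hfac, neg_le, le_div_iff₀ ht0]
    have h := mul_le_mul_of_nonneg_left hu (mul_nonneg hE0.le ht0.le)
    have h' : 0 ≤ Real.exp (-x) * (t * a) := by positivity
    linarith
  have hupper : P * (1 - 2 * a) ≤ 14/t := by
    rw [hfac, le_div_iff₀ ht0]
    have h := mul_le_mul_of_nonneg_left hu1 (mul_nonneg hE0.le ht0.le)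
    have h' := mul_pos hF0 ht0
    linarith
  have habs : |P| * (1 - 2 * a) ≤ 14/t := by
    have h := abs_le.2 ⟨hlower, hupper⟩
    rwa [abs_mul, abs_of_pos (show 0 < 1 - 2 * a by linarith)] at h
  have hP : |P| ≤ 30/t := by
    have h := mul_le_mul_of_nonneg_left (show 2/3 ≤ 1 - 2 * a by linarith) (abs_nonneg P)
    have h' : 0 < 1/t := by positivity
    have e₁ : 14/t = 14 * (1/t) := by ring
    have e₂ : 30/t = 30 * (1/t) := by ring
    linarith
  have hs : Real.sqrt (1 + t ^ 2) ≤ 2 * t :=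
    Real.sqrt_le_iff.2 ⟨by positivity, by nlinarith⟩
  calc |P| ≤ 30/t := hP
    _ = 60 * (2 * t)⁻¹ := by field_simp; norm_num
    _ ≤ 60 * (Real.sqrt (1 + t ^ 2))⁻¹ := by gcongr
end

section
/- There exists a constant C > 0 such that for every t ≥ 1 and every λ with 0 ≤ λ < 1/8 the following holds: |e^{tλ/2}·(e^{t(−1/2+√(1/4−λ))} − e^{−tλ})| ≤ C·t·λ²·e^{−tλ/2} if λ ≤ ⟨t⟩^{−1/2}, and |e^{tλ/2}·(e^{t(−1/2+√(1/4−λ))} − e^{−tλ})| ≤ C·e^{−(t/2)·⟨t⟩^{−1/2}} if λ > ⟨t⟩^{−1/2}. Here one may use the identity e^{tλ/2}·(e^{t(−1/2+√(1/4−λ))} − e^{−tλ}) = e^{−tλ/2}·(exp(−4tλ²/(1+√(1−4λ))²) − 1). -/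
/-- Japanese bracket `⟨t⟩ = (1+t²)^{1/2}`. -/
noncomputable def jbracket (t : ℝ) : ℝ := Real.sqrt (1 + t^2)

/-- Two-sided comparison of the lower branch `-1/2 + √(1/4 - x)` with its first-order expansion. -/
theorem lower_branch_add_self_mem_Icc {x : ℝ} (hx0 : 0 ≤ x) (hx : x < 1/8) :
    -1/2 + Real.sqrt (1/4 - x) + x ∈ Set.Icc (-(4 * x^2)) 0 := by
  have hlow : 1/2 - x - 4 * x^2 ≤ Real.sqrt (1/4 - x) :=
    Real.le_sqrt_of_sq_le (by nlinarith [mul_nonneg (sq_nonneg x) (by nlinarith :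
      0 ≤ 3 - 8 * x - 16 * x^2)])
  have hup : Real.sqrt (1/4 - x) ≤ 1/2 - x :=
    Real.sqrt_le_iff.mpr ⟨by linarith, by nlinarith [sq_nonneg x]⟩
  constructor <;> linarith

theorem exp_mul_lower_branch_sub_heat (t x : ℝ) :
    Real.exp (t * x / 2) *
        (Real.exp (t * (-1/2 + Real.sqrt (1/4 - x))) - Real.exp (-t * x)) =
      Real.exp (-t * x / 2) *
        (Real.exp (t * (-1/2 + Real.sqrt (1/4 - x) + x)) - 1) := by
  rw [mul_sub, mul_sub, ← Real.exp_add, ← Real.exp_add, ← Real.exp_add, mul_one]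
  congr 2 <;> ring

theorem abs_exp_mul_lower_branch_sub_heat_le {t x : ℝ} (ht : 0 ≤ t) (hx0 : 0 ≤ x)
    (hx : x < 1/8) :
    |Real.exp (t * x / 2) *
        (Real.exp (t * (-1/2 + Real.sqrt (1/4 - x))) - Real.exp (-t * x))| ≤
      min 1 (4 * t * x^2) * Real.exp (-t * x / 2) := by
  obtain ⟨hlow, hup⟩ := lower_branch_add_self_mem_Icc hx0 hx
  rw [exp_mul_lower_branch_sub_heat, abs_mul, Real.abs_exp, mul_comm]
  set z := t * (-1/2 + Real.sqrt (1/4 - x) + x) with hz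
  have hz0 : z ≤ 0 := mul_nonpos_of_nonneg_of_nonpos ht hup
  have hzlow : -(4 * t * x^2) ≤ z := by
    linarith [mul_le_mul_of_nonneg_left hlow ht]
  gcongr
  rw [abs_of_nonpos (by linarith [Real.exp_le_one_iff.mpr hz0])]
  exact le_min (by linarith [Real.exp_pos z]) (by linarith [Real.add_one_le_exp z])

theorem lower_branch_heat_comparison :
    ∃ C > (0:ℝ), ∀ t ≥ (1:ℝ), ∀ lam : ℝ, 0 ≤ lam → lam < 1/8 →
      (lam ≤ jbracket t ^ (-(1:ℝ)/2) →
        |Real.exp (t * lam / 2) *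
            (Real.exp (t * (-1/2 + Real.sqrt (1/4 - lam))) - Real.exp (-t * lam))|
          ≤ C * t * lam^2 * Real.exp (-t * lam / 2)) ∧
      (lam > jbracket t ^ (-(1:ℝ)/2) →
        |Real.exp (t * lam / 2) *
            (Real.exp (t * (-1/2 + Real.sqrt (1/4 - lam))) - Real.exp (-t * lam))|
          ≤ C * Real.exp (-(t/2) * jbracket t ^ (-(1:ℝ)/2))) := by
  refine ⟨4, by norm_num, fun t ht x hx0 hx => ?_⟩
  have hmain := abs_exp_mul_lower_branch_sub_heat_le (by linarith : 0 ≤ t) hx0 hx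
  refine ⟨fun _ => hmain.trans ?_, fun hgt => hmain.trans ?_⟩
  · gcongr
    exact min_le_right _ _
  · have hexp : -t * x / 2 ≤ -(t/2) * jbracket t ^ (-(1:ℝ)/2) := by
      linarith [mul_le_mul_of_nonneg_left hgt.le (by linarith : 0 ≤ t / 2)]
    gcongr
    exact (min_le_left _ _).trans (by norm_num)
end

section
/- There exists a constant C > 0 such that for every t > 0, every λ with 1/4 < λ ≤ 1, and k ∈ {0,1}, one has |∂ₜᵏ(𝒟(t,λ) − e^{−tλ})| ≤ C·e^{−t/4}, where ∂ₜ⁰g = g and ∂ₜ¹(𝒟(t,λ) − e^{−tλ}) = ∂ₜ𝒟(t,λ) + λ·e^{−tλ}. (Intermediate-frequency symbol bound used in the proof of Theorem 2.2.) -/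
/-- `∂ₜᵏ(𝒟(t,λ) − e^{−tλ})` for `k = 0, 1`. -/
noncomputable def dwHeatDiff (k : ℕ) (t lam : ℝ) : ℝ :=
  if k = 0 then dwSymbol t lam - Real.exp (-t * lam)
  else dwSymbolDt t lam + lam * Real.exp (-t * lam)

theorem mul_exp_neg_half_le (t : ℝ) : t * Real.exp (-t/2) ≤ 4 * Real.exp (-t/4) := by
  have h : t / 4 ≤ Real.exp (t/4) := by linarith [Real.add_one_le_exp (t/4)]
  have h2 : Real.exp (t/4) * Real.exp (-t/2) = Real.exp (-t/4) := by
    rw [← Real.exp_add]; congr 1; ring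
  nlinarith [mul_le_mul_of_nonneg_right h (Real.exp_pos (-t/2)).le]

theorem abs_dwSymbol_le {t lam : ℝ} (ht : 0 < t) (hl : 1/4 < lam) :
    |dwSymbol t lam| ≤ 4 * Real.exp (-t/4) := by
  have hs : 0 < Real.sqrt (lam - 1/4) := Real.sqrt_pos.mpr (by linarith)
  have hsin : |Real.sin (t * Real.sqrt (lam - 1/4))| ≤ t * Real.sqrt (lam - 1/4) :=
    Real.abs_sin_le_abs.trans_eq (abs_of_pos (mul_pos ht hs))
  rw [dwSymbol, if_neg (by linarith), if_neg hl.ne', abs_div, abs_mul, abs_of_pos hs,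
    Real.abs_exp, div_le_iff₀ hs]
  calc Real.exp (-t/2) * |Real.sin (t * Real.sqrt (lam - 1/4))|
      ≤ Real.exp (-t/2) * (t * Real.sqrt (lam - 1/4)) := by gcongr
    _ = t * Real.exp (-t/2) * Real.sqrt (lam - 1/4) := by ring
    _ ≤ _ := mul_le_mul_of_nonneg_right (mul_exp_neg_half_le t) hs.le

theorem abs_dwSymbolDt_le {t lam : ℝ} (ht : 0 < t) (hl : 1/4 < lam) :
    |dwSymbolDt t lam| ≤ 3 * Real.exp (-t/4) := by
  have hD := abs_le.mp (abs_dwSymbol_le ht hl)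
  have hcos : |Real.exp (-t/2) * Real.cos (t * Real.sqrt (lam - 1/4))| ≤ Real.exp (-t/4) := by
    rw [abs_mul, Real.abs_exp]
    calc _ ≤ Real.exp (-t/2) * 1 := by gcongr; exact Real.abs_cos_le_one _
      _ ≤ _ := by rw [mul_one]; exact Real.exp_le_exp.mpr (by linarith)
  have hc := abs_le.mp hcos
  rw [dwSymbolDt, if_neg (not_le.mpr hl), abs_le]
  constructor <;> linarith [hD.1, hD.2, hc.1, hc.2]

theorem mid_freq_symbol_bound :
    ∃ C > (0:ℝ), ∀ t > (0:ℝ), ∀ lam : ℝ, 1/4 < lam → lam ≤ 1 →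
      ∀ k : ℕ, k = 0 ∨ k = 1 →
        |dwHeatDiff k t lam| ≤ C * Real.exp (-t/4) := by
  refine ⟨5, by norm_num, fun t ht lam hl hl1 k hk => ?_⟩
  have hE : Real.exp (-t * lam) ≤ Real.exp (-t/4) := Real.exp_le_exp.mpr (by nlinarith)
  have hE0 := Real.exp_pos (-t * lam)
  rcases hk with rfl | rfl
  · have hD := abs_le.mp (abs_dwSymbol_le ht hl)
    rw [dwHeatDiff, if_pos rfl, abs_le]
    constructor <;> linarith [hD.1, hD.2]
  · have hD := abs_le.mp (abs_dwSymbolDt_le ht hl)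
    have hlE : lam * Real.exp (-t * lam) ≤ Real.exp (-t * lam) :=
      mul_le_of_le_one_left hE0.le hl1
    have hlE0 : 0 < lam * Real.exp (-t * lam) := mul_pos (by linarith) hE0
    rw [dwHeatDiff, if_neg one_ne_zero, abs_le]
    constructor <;> linarith [hD.1, hD.2]
end

section
/- Let q > 0. For every f ∈ L¹(ℝ), the function 𝓛₊[f] belongs to L¹(ℝ) and ‖𝓛₊[f]‖_{L¹(ℝ)} ≤ 2·‖f‖_{L¹(ℝ)}. (Boundedness on L¹ of the wave operator-type transform arising from the Schrödinger operator with a repulsive delta potential; used in the proof of the dispersive estimate (6.2) of the paper.) -/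
open MeasureTheory

/-- The wave operator-type transform `𝓛₊` for the Schrödinger operator with a
repulsive delta potential of strength `q`. -/
noncomputable def Lplus (q : ℝ) (f : ℝ → ℝ) (x : ℝ) : ℝ :=
  f x - q * Set.indicator (Set.Iio (0:ℝ))
    (fun x => Real.exp (q * x) * ∫ y in x..(-x), Real.exp (q * |y|) * f y) x

/-- The nonnegative kernel of the integral part of `𝓛₊`. -/
noncomputable def LplusKernel (q x y : ℝ) : ℝ :=
  (Set.Iio (-|y|)).indicator (fun x => q * Real.exp (q * (x + |y|))) x

lemma LplusKernel_nonneg {q : ℝ} (hq : 0 ≤ q) (x y : ℝ) : 0 ≤ LplusKernel q x y :=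
  Set.indicator_nonneg (fun _ _ => by positivity) x

lemma measurable_LplusKernel (q : ℝ) : Measurable fun p : ℝ × ℝ => LplusKernel q p.1 p.2 := by
  have hS : MeasurableSet {p : ℝ × ℝ | p.1 < -|p.2|} :=
    measurableSet_lt measurable_fst (by fun_prop)
  exact (show Measurable fun p : ℝ × ℝ => q * Real.exp (q * (p.1 + |p.2|)) by
    fun_prop).indicator hS

lemma integrable_LplusKernel {q : ℝ} (hq : 0 < q) (y : ℝ) :
    Integrable fun x => LplusKernel q x y := by
  refine (integrable_indicator_iff measurableSet_Iio).2 ?_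
  simp_rw [mul_add, Real.exp_add]
  exact (((integrableOn_exp_mul_Iic hq _).mono_set Set.Iio_subset_Iic_self).mul_const _).const_mul _

lemma integral_LplusKernel {q : ℝ} (hq : 0 < q) (y : ℝ) :
    ∫ x, LplusKernel q x y = 1 := by
  simp only [LplusKernel]
  rw [integral_indicator measurableSet_Iio, ← integral_Iic_eq_integral_Iio]
  simp_rw [mul_add, Real.exp_add]
  rw [integral_const_mul, integral_mul_const, integral_exp_mul_Iic hq, div_mul_eq_mul_div,
    ← Real.exp_add, mul_div_cancel₀ _ hq.ne']
  simp

lemma integrable_LplusKernel_mul {q : ℝ} (hq : 0 < q) {f : ℝ → ℝ} (hf : Integrable f) :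
    Integrable (fun p : ℝ × ℝ => LplusKernel q p.1 p.2 * f p.2) (volume.prod volume) := by
  have hm : AEStronglyMeasurable (fun p : ℝ × ℝ => LplusKernel q p.1 p.2 * f p.2)
      (volume.prod volume) :=
    (measurable_LplusKernel q).aestronglyMeasurable.mul hf.1.comp_snd
  refine (integrable_prod_iff' hm).2 ⟨?_, ?_⟩
  · exact .of_forall fun y => (integrable_LplusKernel hq y).mul_const (f y)
  · simpa only [norm_mul, Real.norm_of_nonneg (LplusKernel_nonneg hq.le _ _),
      integral_mul_const, integral_LplusKernel hq, one_mul] using hf.norm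

lemma Lplus_eq_sub_integral (q : ℝ) (f : ℝ → ℝ) (x : ℝ) :
    Lplus q f x = f x - ∫ y, LplusKernel q x y * f y := by
  have hK : ∀ y, LplusKernel q x y * f y = (Set.Ioo x (-x)).indicator
      (fun y => q * Real.exp (q * x) * (Real.exp (q * |y|) * f y)) y := by
    intro y
    have hiff : x ∈ Set.Iio (-|y|) ↔ y ∈ Set.Ioo x (-x) := by
      rw [Set.mem_Iio, lt_neg, abs_lt, neg_neg, Set.mem_Ioo]
    by_cases h : x ∈ Set.Iio (-|y|)
    · rw [LplusKernel, Set.indicator_of_mem h, Set.indicator_of_mem (hiff.1 h), mul_add,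
        Real.exp_add]
      ring
    · rw [LplusKernel, Set.indicator_of_notMem h, Set.indicator_of_notMem (mt hiff.2 h), zero_mul]
  simp_rw [hK]
  rw [Lplus, integral_indicator measurableSet_Ioo, integral_const_mul]
  rcases lt_or_ge x 0 with hx | hx
  · rw [Set.indicator_of_mem (Set.mem_Iio.2 hx), intervalIntegral.integral_of_le (by linarith),
      integral_Ioc_eq_integral_Ioo, mul_assoc]
  · rw [Set.indicator_of_notMem (Set.notMem_Iio.2 hx), Set.Ioo_eq_empty (by linarith)]
    simp

theorem Lplus_L1_bound (q : ℝ) (hq : 0 < q) (f : ℝ → ℝ)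
    (hf : Integrable f) :
    Integrable (Lplus q f) ∧ ∫ x, |Lplus q f x| ≤ 2 * ∫ x, |f x| := by
  have hK := integrable_LplusKernel_mul hq hf
  have hG : Integrable fun x => ∫ y, LplusKernel q x y * f y := hK.integral_prod_left
  have hL : Lplus q f = fun x => f x - ∫ y, LplusKernel q x y * f y :=
    funext (Lplus_eq_sub_integral q f)
  have hswap : ∫ x, ∫ y, ‖LplusKernel q x y * f y‖ = ∫ y, |f y| := by
    rw [integral_integral_swap hK.norm]
    simp only [norm_mul, Real.norm_of_nonneg (LplusKernel_nonneg hq.le _ _),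
      integral_mul_const, integral_LplusKernel hq, one_mul, Real.norm_eq_abs]
  rw [hL]
  refine ⟨hf.sub hG, ?_⟩
  calc ∫ x, |f x - ∫ y, LplusKernel q x y * f y|
      ≤ ∫ x, (|f x| + ∫ y, ‖LplusKernel q x y * f y‖) :=
        integral_mono (hf.sub hG).abs (hf.abs.add hK.integral_norm_prod_left) fun x =>
          (abs_sub _ _).trans
            (add_le_add_right (norm_integral_le_integral_norm fun y => LplusKernel q x y * f y) _)
    _ = 2 * ∫ x, |f x| := by
        rw [integral_add hf.abs hK.integral_norm_prod_left, hswap, two_mul]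
end
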